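/- arXiv:0712.3213 — 2 statements merged into one kernel-verified Lean document; each statement's English description precedes it below -/
import Mathlib

section
/- Let c be an odd positive integer and n ≥ 0. The number of lattice paths from (0,0) with terminus (cn, 2n) all of whose visited lattice points (x,y) satisfy 2x ≥ c·y (i.e. paths lying weakly below the line of the boundary of slope c/2 through the origin) equals (1/(cn+1))·binomial((c+2)n, 2n) − (1/2)·Σ_{i=0}^{n−1} M_i·M_{n−1−i}, where M_i = (1/(2i+1))·binomial((c+2)i + (c+1)/2, 2i). -/
/-- `M_i = (1/(2i+1)) · C((c+2)i + (c+1)/2, 2i)` (here `c` is odd, so `(c+1)/2` is exact). -/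
noncomputable def Mq (c i : ℕ) : ℚ :=
  (1 / (2 * (i : ℚ) + 1)) * (((c + 2) * i + (c + 1) / 2).choose (2 * i) : ℚ)

/-- The coefficient of `s ^ m` in `T ^ r`, where `T = 1 + s * T ^ d`, as a polynomial in `r`. -/
noncomputable def binomialSeriesCoeff (d : ℚ) : ℕ → Polynomial ℚ
  | 0 => 1
  | m + 1 => Polynomial.C (1 / ((m + 1).factorial : ℚ)) * Polynomial.X *
      (descPochhammer ℚ m).comp (Polynomial.X + Polynomial.C ((m + 1) * d - 1))

theorem binomialSeriesCoeff_succ_eval (d : ℚ) (m : ℕ) (r : ℚ) :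
    (binomialSeriesCoeff d (m + 1)).eval r =
      1 / ((m + 1).factorial : ℚ) * r * (descPochhammer ℚ m).eval (r + ((m + 1) * d - 1)) := by
  simp [binomialSeriesCoeff]

theorem descPochhammer_succ_eval_left (m : ℕ) (y : ℚ) :
    (descPochhammer ℚ (m + 1)).eval y = y * (descPochhammer ℚ m).eval (y - 1) := by
  simp [descPochhammer_succ_left]

theorem binomialSeriesCoeff_pascal (d : ℚ) (m : ℕ) (r : ℚ) :
    (binomialSeriesCoeff d (m + 1)).eval (r + 1) =
      (binomialSeriesCoeff d (m + 1)).eval r + (binomialSeriesCoeff d m).eval (r + d) := by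
  cases m with
  | zero => simp [binomialSeriesCoeff]
  | succ m =>
    simp only [binomialSeriesCoeff_succ_eval]
    rw [descPochhammer_succ_eval_left, descPochhammer_succ_eval m (r + _)]
    have h : (((m + 1 + 1).factorial : ℕ) : ℚ) = (m + 2) * ((m + 1).factorial : ℚ) := by
      rw [Nat.factorial_succ (m + 1)]; push_cast; ring
    have h0 : ((m + 1).factorial : ℚ) ≠ 0 := by positivity
    have h2 : (m : ℚ) + 2 ≠ 0 := by positivity
    rw [h]
    push_cast
    have e1 : r + 1 + ((m + 1 + 1) * d - 1) - 1 = r + ((m + 1 + 1) * d - 1) := by ring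
    have e2 : r + d + ((m + 1) * d - 1) = r + ((m + 1 + 1) * d - 1) := by ring
    rw [e1, e2]
    field_simp
    ring

theorem binomialSeriesCoeff_eval_zero (d : ℚ) (m : ℕ) :
    (binomialSeriesCoeff d m).eval 0 = if m = 0 then 1 else 0 := by
  cases m <;> simp [binomialSeriesCoeff]

/-- A polynomial over `ℚ` vanishing at `0` and invariant under the shift by `1` is zero. -/
theorem Polynomial.eq_zero_of_eval_add_one (p : Polynomial ℚ) (h0 : p.eval 0 = 0)
    (h : ∀ r, p.eval (r + 1) = p.eval r) : p = 0 := by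
  have hn : ∀ n : ℕ, p.eval (n : ℚ) = 0 := by
    intro n
    induction n with
    | zero => simpa using h0
    | succ n ih => push_cast; rw [h, ih]
  refine Polynomial.eq_zero_of_infinite_isRoot p
    ((Set.infinite_range_of_injective (Nat.cast_injective (R := ℚ))).mono ?_)
  rintro _ ⟨n, rfl⟩
  exact hn n

/-- The generalised binomial series `T ^ r`, where `T = 1 + s * T ^ d`. -/
noncomputable def binomialPowerSeries (d r : ℚ) : PowerSeries ℚ :=
  PowerSeries.mk fun m => (binomialSeriesCoeff d m).eval r

theorem binomialPowerSeries_zero (d : ℚ) : binomialPowerSeries d 0 = 1 := by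
  ext m
  simp [binomialPowerSeries, binomialSeriesCoeff_eval_zero, PowerSeries.coeff_one]

theorem binomialPowerSeries_add_one (d r : ℚ) :
    binomialPowerSeries d (r + 1) =
      binomialPowerSeries d r + PowerSeries.X * binomialPowerSeries d (r + d) := by
  ext m
  cases m with
  | zero => simp [binomialPowerSeries, binomialSeriesCoeff]
  | succ m =>
    simp [binomialPowerSeries, PowerSeries.coeff_succ_X_mul, binomialSeriesCoeff_pascal]

theorem binomialPowerSeries_add (d r q : ℚ) :
    binomialPowerSeries d (r + q) = binomialPowerSeries d r * binomialPowerSeries d q := by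
  ext m
  induction m generalizing r with
  | zero => simp [binomialPowerSeries, binomialSeriesCoeff, PowerSeries.coeff_mul]
  | succ m ih =>
    set p : Polynomial ℚ := (binomialSeriesCoeff d (m + 1)).comp (Polynomial.X + Polynomial.C q) -
      ∑ x ∈ Finset.HasAntidiagonal.antidiagonal (m + 1),
        binomialSeriesCoeff d x.1 * Polynomial.C ((binomialSeriesCoeff d x.2).eval q) with hp
    have hev : ∀ r, p.eval r = PowerSeries.coeff (m + 1) (binomialPowerSeries d (r + q)) -
        PowerSeries.coeff (m + 1) (binomialPowerSeries d r * binomialPowerSeries d q) := by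
      intro r
      simp [hp, binomialPowerSeries, PowerSeries.coeff_mul, Polynomial.eval_finsetSum]
    have hzero : p = 0 := by
      apply Polynomial.eq_zero_of_eval_add_one
      · rw [hev, binomialPowerSeries_zero]
        simp
      · intro r
        rw [hev, hev, add_right_comm, binomialPowerSeries_add_one, binomialPowerSeries_add_one,
          add_mul, mul_assoc, map_add, map_add, PowerSeries.coeff_succ_X_mul,
          PowerSeries.coeff_succ_X_mul, add_right_comm r q d, ih]
        ring
    have := hev r
    rw [hzero, Polynomial.eval_zero] at this
    linarith

theorem binomialPowerSeries_natCast_mul (d r : ℚ) (k : ℕ) :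
    binomialPowerSeries d (k * r) = binomialPowerSeries d r ^ k := by
  induction k with
  | zero => simp [binomialPowerSeries_zero]
  | succ k ih =>
    rw [pow_succ, ← ih, ← binomialPowerSeries_add]
    congr 1
    push_cast
    ring

theorem descPochhammer_eval_natCast_eq_choose (N m : ℕ) :
    (descPochhammer ℚ m).eval (N : ℚ) = m.factorial * (N.choose m : ℚ) := by
  rw [descPochhammer_eval_eq_descFactorial, Nat.descFactorial_eq_factorial_mul_choose]
  push_cast
  ring

/-- Lists of steps with `x` R-steps and `y` U-steps that stay weakly below the line `cx = 2y`. -/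
def pathsBelow (c x y : ℕ) : Set (List Bool) :=
  {P | P.count false = x ∧ P.count true = y ∧
    ∀ p : List Bool, p <+: P → c * p.count true ≤ 2 * p.count false}

theorem pathsBelow_finite (c x y : ℕ) : (pathsBelow c x y).Finite := by
  refine (List.finite_length_eq Bool (x + y)).subset ?_
  rintro P ⟨h1, h2, -⟩
  have := List.count_false_add_count_true P
  simp only [Set.mem_ofPred_eq]
  omega

theorem pathsBelow_eq_empty {c x y : ℕ} (h : 2 * x < c * y) : pathsBelow c x y = ∅ := by
  ext P
  simp only [pathsBelow, Set.mem_ofPred_eq, Set.mem_empty_iff_false, iff_false, not_and]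
  rintro rfl rfl hP
  exact absurd (hP P List.prefix_rfl) (by omega)

theorem pathsBelow_zero_zero (c : ℕ) : pathsBelow c 0 0 = {[]} := by
  ext P
  simp only [pathsBelow, Set.mem_ofPred_eq, Set.mem_singleton_iff]
  constructor
  · rintro ⟨h1, h2, -⟩
    have := List.count_false_add_count_true P
    exact List.length_eq_zero_iff.mp (by omega)
  · rintro rfl
    simp

theorem append_singleton_mem_pathsBelow {c x y : ℕ} (h : c * y ≤ 2 * x) (P : List Bool)
    (b : Bool) : P ++ [b] ∈ pathsBelow c x y ↔
      P.count false + [b].count false = x ∧ P.count true + [b].count true = y ∧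
        P ∈ pathsBelow c (P.count false) (P.count true) := by
  simp only [pathsBelow, Set.mem_ofPred_eq, List.count_append, List.prefix_concat_iff, true_and]
  constructor
  · rintro ⟨h1, h2, h3⟩
    exact ⟨h1, h2, fun p hp => h3 p (Or.inr hp)⟩
  · rintro ⟨h1, h2, h3⟩
    refine ⟨h1, h2, ?_⟩
    rintro p (rfl | hp)
    · rw [List.count_append, List.count_append, h1, h2]
      exact h
    · exact h3 p hp

theorem ncard_pathsBelow_succ_zero (c x : ℕ) :
    (pathsBelow c (x + 1) 0).ncard = (pathsBelow c x 0).ncard := by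
  rw [← Set.ncard_image_of_injective (pathsBelow c x 0) (List.append_left_injective [false])]
  congr 1
  ext P
  rcases List.eq_nil_or_concat' P with rfl | ⟨L, b, rfl⟩
  · simp [pathsBelow]
  · rw [append_singleton_mem_pathsBelow (by simp)]
    cases b
    · simp [pathsBelow]
    · simp

theorem ncard_pathsBelow_succ_succ {c x y : ℕ} (h : c * (y + 1) ≤ 2 * (x + 1)) :
    (pathsBelow c (x + 1) (y + 1)).ncard =
      (pathsBelow c x (y + 1)).ncard + (pathsBelow c (x + 1) y).ncard := by
  rw [← Set.ncard_image_of_injective (pathsBelow c x (y + 1)) (List.append_left_injective [false]),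
    ← Set.ncard_image_of_injective (pathsBelow c (x + 1) y) (List.append_left_injective [true]),
    ← Set.ncard_union_eq _ ((pathsBelow_finite _ _ _).image _) ((pathsBelow_finite _ _ _).image _)]
  · congr 1
    ext P
    rcases List.eq_nil_or_concat' P with rfl | ⟨L, b, rfl⟩
    · simp [pathsBelow]
    · rw [append_singleton_mem_pathsBelow h]
      cases b <;> simp [pathsBelow]
  · rw [Set.disjoint_left]
    rintro _ ⟨L, -, rfl⟩ ⟨L', -, h'⟩
    simp at h'

/-- For roots `a`, `b` of `z ^ 2 = 1 + X * z ^ (c + 2)`, the generating function of the paths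
ending at excess `2x - cy = k`. -/
noncomputable def excessSeries (a b : PowerSeries ℚ) (k : ℕ) : PowerSeries ℚ :=
  -(a * b) * ∑ i ∈ Finset.range (k + 1), a ^ i * b ^ (k + 1 - 1 - i)

theorem excessSeries_mul (a b : PowerSeries ℚ) (k : ℕ) :
    excessSeries a b k * (a - b) = -(a * b) * (a ^ (k + 1) - b ^ (k + 1)) := by
  rw [excessSeries, mul_assoc, (Commute.all a b).geom_sum₂_mul]

section Recurrence

variable {a b : PowerSeries ℚ} {c : ℕ}

theorem excessSeries_zero (hab : a - b ≠ 0) (ha : a ^ 2 = 1 + PowerSeries.X * a ^ (c + 2))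
    (hb : b ^ 2 = 1 + PowerSeries.X * b ^ (c + 2)) :
    excessSeries a b 0 = 1 + PowerSeries.X * excessSeries a b c := by
  apply mul_right_cancel₀ hab
  rw [add_mul, mul_assoc, excessSeries_mul, excessSeries_mul]
  linear_combination (-b) * ha + a * hb

theorem excessSeries_one (hab : a - b ≠ 0) (ha : a ^ 2 = 1 + PowerSeries.X * a ^ (c + 2))
    (hb : b ^ 2 = 1 + PowerSeries.X * b ^ (c + 2)) :
    excessSeries a b 1 = PowerSeries.X * excessSeries a b (c + 1) := by
  apply mul_right_cancel₀ hab
  rw [mul_assoc, excessSeries_mul, excessSeries_mul]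
  linear_combination (-(a * b)) * ha + a * b * hb

theorem excessSeries_add_two (hab : a - b ≠ 0) (ha : a ^ 2 = 1 + PowerSeries.X * a ^ (c + 2))
    (hb : b ^ 2 = 1 + PowerSeries.X * b ^ (c + 2)) (k : ℕ) :
    excessSeries a b (k + 2) =
      excessSeries a b k + PowerSeries.X * excessSeries a b (k + 2 + c) := by
  apply mul_right_cancel₀ hab
  rw [add_mul, mul_assoc, excessSeries_mul, excessSeries_mul, excessSeries_mul]
  linear_combination (-(a * b)) * a ^ (k + 1) * ha + a * b * b ^ (k + 1) * hb

theorem ncard_pathsBelow_eq_coeff (hpos : 0 < c) (hab : a - b ≠ 0)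
    (ha : a ^ 2 = 1 + PowerSeries.X * a ^ (c + 2))
    (hb : b ^ 2 = 1 + PowerSeries.X * b ^ (c + 2)) (y x k : ℕ) (hk : c * y + k = 2 * x) :
    ((pathsBelow c x y).ncard : ℚ) = PowerSeries.coeff y (excessSeries a b k) := by
  induction y generalizing x k with
  | zero =>
    induction x generalizing k with
    | zero =>
      obtain rfl : k = 0 := by omega
      rw [pathsBelow_zero_zero, excessSeries_zero hab ha hb]
      simp
    | succ x ih =>
      obtain ⟨k, rfl⟩ : ∃ j, k = j + 2 := ⟨k - 2, by omega⟩
      rw [ncard_pathsBelow_succ_zero, excessSeries_add_two hab ha hb, ih k (by omega)]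
      simp
  | succ y ihy =>
    induction x generalizing k with
    | zero =>
      have : 0 < c * (y + 1) := by positivity
      omega
    | succ x ih =>
      rw [ncard_pathsBelow_succ_succ (by omega), Nat.cast_add,
        ihy (x + 1) (k + c) (by rw [← hk]; ring)]
      match k, hk with
      | 0, hk =>
        rw [pathsBelow_eq_empty (by omega), excessSeries_zero hab ha hb]
        simp [PowerSeries.coeff_succ_X_mul, PowerSeries.coeff_one]
      | 1, hk =>
        rw [pathsBelow_eq_empty (by omega), excessSeries_one hab ha hb]
        simp [PowerSeries.coeff_succ_X_mul, add_comm]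
      | k + 2, hk =>
        rw [ih k (by omega), excessSeries_add_two hab ha hb k, map_add,
          PowerSeries.coeff_succ_X_mul]

end Recurrence

theorem Finset.sum_antidiagonal_two_mul_odd (f : ℕ → ℚ) (n : ℕ) :
    ∑ x ∈ Finset.HasAntidiagonal.antidiagonal (2 * n), f x.1 * ((1 - (-1) ^ x.2) * f x.2) =
      2 * ∑ i ∈ Finset.range n, f (2 * i + 1) * f (2 * (n - 1 - i) + 1) := by
  rw [Finset.Nat.sum_antidiagonal_eq_sum_range_succ_mk, Finset.mul_sum]
  have hsplit : ∀ (g : ℕ → ℚ) (m : ℕ), ∑ i ∈ Finset.range (2 * m + 1), g i =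
      ∑ i ∈ Finset.range m, g (2 * i + 1) + ∑ i ∈ Finset.range (m + 1), g (2 * i) := by
    intro g m
    induction m with
    | zero => simp
    | succ m ih =>
      rw [Finset.sum_range_succ _ (m + 1), Finset.sum_range_succ _ m, show
        2 * (m + 1) + 1 = 2 * m + 1 + 1 + 1 by ring, Finset.sum_range_succ, Finset.sum_range_succ,
        ih, show 2 * (m + 1) = 2 * m + 1 + 1 by ring]
      ring
  rw [hsplit]
  have heven : ∑ i ∈ Finset.range (n + 1),
      f (2 * i) * ((1 - (-1) ^ (2 * n - 2 * i)) * f (2 * n - 2 * i)) = 0 := by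
    refine Finset.sum_eq_zero fun i _ => ?_
    rw [← Nat.mul_sub, pow_mul]
    simp
  rw [heven, add_zero]
  refine Finset.sum_congr rfl fun i hi => ?_
  have hi := Finset.mem_range.mp hi
  rw [show 2 * n - (2 * i + 1) = 2 * (n - 1 - i) + 1 by omega, pow_succ, pow_mul]
  norm_num
  ring

theorem coeff_binomialPowerSeries_half_odd {c : ℕ} (hodd : Odd c) (i : ℕ) :
    PowerSeries.coeff (2 * i + 1) (binomialPowerSeries ((c + 2) / 2) (1 / 2)) = Mq c i / 2 := by
  obtain ⟨e, rfl⟩ := hodd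
  rw [binomialPowerSeries, PowerSeries.coeff_mk, binomialSeriesCoeff_succ_eval, Mq,
    show (2 * e + 1 + 1) / 2 = e + 1 by omega,
    show (1 : ℚ) / 2 + (((2 * i : ℕ) + 1) * (((2 * e + 1 : ℕ) + 2) / 2) - 1) =
      (((2 * e + 1 + 2) * i + (e + 1) : ℕ) : ℚ) by push_cast; ring,
    descPochhammer_eval_natCast_eq_choose, Nat.factorial_succ]
  have : ((2 * i).factorial : ℚ) ≠ 0 := by positivity
  have : (2 * (i : ℚ) + 1) ≠ 0 := by positivity
  push_cast
  field_simp

theorem coeff_binomialPowerSeries_one_even (c n : ℕ) :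
    PowerSeries.coeff (2 * n) (binomialPowerSeries ((c + 2) / 2) 1) =
      (1 / ((c : ℚ) * n + 1)) * (((c + 2) * n).choose (2 * n) : ℚ) := by
  rw [binomialPowerSeries, PowerSeries.coeff_mk]
  rcases Nat.eq_zero_or_pos n with rfl | hn
  · simp [binomialSeriesCoeff]
  obtain ⟨m, hm⟩ : ∃ m, 2 * n = m + 1 := ⟨2 * n - 1, by omega⟩
  have hm' : (m : ℚ) + 1 = 2 * n := by exact_mod_cast hm.symm
  have h1 := descPochhammer_eval_natCast_eq_choose ((c + 2) * n) (m + 1)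
  rw [descPochhammer_succ_eval] at h1
  rw [hm, binomialSeriesCoeff_succ_eval, hm',
    show (1 : ℚ) + (2 * n * ((c + 2) / 2) - 1) = (((c + 2) * n : ℕ) : ℚ) by push_cast; ring]
  have h2 : (((c + 2) * n : ℕ) : ℚ) - m = c * n + 1 := by
    push_cast
    linear_combination -hm'
  rw [h2] at h1
  have : ((m + 1).factorial : ℚ) ≠ 0 := by positivity
  have : (c : ℚ) * n + 1 ≠ 0 := by positivity
  field_simp
  linear_combination h1

/-- Lattice paths are lists of steps (`false` = R-step `(1,0)`, `true` = U-step `(0,1)`)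
starting at the origin; a path lies weakly below the line `cx = 2y` of slope `c/2` iff
each visited point `(x,y)` (given by a prefix) satisfies `2x ≥ cy`. -/
theorem stmt12 (c : ℕ) (hodd : Odd c) (hpos : 0 < c) (n : ℕ) :
    (Nat.card {P : List Bool //
        P.count false = c * n ∧ P.count true = 2 * n ∧
        ∀ p : List Bool, p <+: P → c * p.count true ≤ 2 * p.count false} : ℚ) =
      (1 / ((c : ℚ) * n + 1)) * (((c + 2) * n).choose (2 * n) : ℚ) -
        (1 / 2) * ∑ i ∈ Finset.range n, Mq c i * Mq c (n - 1 - i) := by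
  set d : ℚ := (c + 2) / 2 with hd
  set S := binomialPowerSeries d (1 / 2) with hS
  set S' := PowerSeries.rescale (-1 : ℚ) S with hS'
  have hS2 : S ^ 2 = binomialPowerSeries d 1 := by
    rw [hS, ← binomialPowerSeries_natCast_mul]
    norm_num
  have ha : S ^ 2 = 1 + PowerSeries.X * S ^ (c + 2) := by
    have h := binomialPowerSeries_add_one d 0
    rw [zero_add, zero_add, binomialPowerSeries_zero] at h
    rw [hS2, h, hS, ← binomialPowerSeries_natCast_mul, hd]
    push_cast
    ring_nf
  have hb : (-S') ^ 2 = 1 + PowerSeries.X * (-S') ^ (c + 2) := by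
    have h := congrArg (PowerSeries.rescale (-1 : ℚ)) ha
    rw [map_add, map_mul, map_pow, map_pow, map_one, PowerSeries.rescale_neg_one_X] at h
    rw [neg_sq, (hodd.add_even even_two).neg_pow, h]
    ring
  have hab : S - -S' ≠ 0 := by
    intro h
    have := congrArg (PowerSeries.coeff 0) h
    simp [hS', hS, binomialPowerSeries, binomialSeriesCoeff, PowerSeries.rescale] at this
  have hcard := ncard_pathsBelow_eq_coeff hpos hab ha hb (2 * n) (c * n) 0 (by ring)
  have hQ : excessSeries S (-S') 0 = S ^ 2 - S * (S - S') := by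
    simp [excessSeries]
    ring
  have hsum : PowerSeries.coeff (2 * n) (S * (S - S')) =
      (1 / 2) * ∑ i ∈ Finset.range n, Mq c i * Mq c (n - 1 - i) := by
    have h := Finset.sum_antidiagonal_two_mul_odd (fun m => PowerSeries.coeff m S) n
    rw [PowerSeries.coeff_mul]
    simp only [hS, hd, coeff_binomialPowerSeries_half_odd hodd] at h
    calc _ = _ := Finset.sum_congr rfl fun x _ => by
          rw [map_sub, hS', PowerSeries.coeff_rescale, sub_mul, one_mul]
      _ = _ := h
      _ = _ := by
          rw [Finset.mul_sum, Finset.mul_sum]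
          exact Finset.sum_congr rfl fun i _ => by ring
  change ((pathsBelow c (c * n) (2 * n)).ncard : ℚ) = _
  rw [hcard, hQ, map_sub, hsum, hS2, hd, coeff_binomialPowerSeries_one_even]
end

section
/- Let n and k be positive integers and let C_j denote the j-th Catalan number. The number of lattice paths from (0,0) with terminus (nk − 1, nk − 1) that lie weakly under the boundary word U^{k−1}(R^k U^k)^{n−1} R^{k−1} equals k·C_{nk−1}. -/
/-- A lattice path is a list of steps: `false` = R-step `(1,0)`, `true` = U-step `(0,1)`,
starting at the origin.  `UnderWord B P` says `P` lies weakly under the boundary word `B`: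
for each `y`, the number of R-steps of `P` preceding its `y`-th U-step is at least the
number of R-steps of `B` preceding the `y`-th U-step of `B` (expressed via the prefixes
ending just before those U-steps). -/
def UnderWord (B P : List Bool) : Prop :=
  ∀ pB rB pP rP : List Bool, B = pB ++ true :: rB → P = pP ++ true :: rP →
    pP.count true = pB.count true → pB.count false ≤ pP.count false

/-- The boundary word `U^{k-1}(R^k U^k)^{n-1} R^{k-1}`. -/
def bdryStaircase (k n : ℕ) : List Bool :=
  List.replicate (k - 1) true ++
    (List.replicate (n - 1) (List.replicate k false ++ List.replicate k true)).flatten ++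
    List.replicate (k - 1) false

/-- The numbers of U-steps of a word on the successive vertical lines `x = 0, 1, 2, …`. -/
def columnHeights : List Bool → List ℕ
  | [] => [0]
  | false :: P => 0 :: columnHeights P
  | true :: P => (columnHeights P).modifyHead (· + 1)

/-- The word with prescribed numbers of U-steps on the vertical lines `x = 0, 1, 2, …`. -/
def ofColumnHeights : List ℕ → List Bool
  | [] => []
  | [a] => List.replicate a true
  | a :: b :: l => List.replicate a true ++ false :: ofColumnHeights (b :: l)

theorem exists_columnHeights_eq_cons (P : List Bool) : ∃ a l, columnHeights P = a :: l := by
  induction P with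
  | nil => exact ⟨0, [], rfl⟩
  | cons s P ih =>
    obtain ⟨a, l, h⟩ := ih
    cases s <;> simp [columnHeights, h]

theorem length_columnHeights (P : List Bool) :
    (columnHeights P).length = P.count false + 1 := by
  induction P with
  | nil => rfl
  | cons s P ih => cases s <;> simp [columnHeights, ih]

theorem sum_columnHeights (P : List Bool) : (columnHeights P).sum = P.count true := by
  induction P with
  | nil => rfl
  | cons s P ih =>
    obtain ⟨a, l, h⟩ := exists_columnHeights_eq_cons P
    rw [h] at ih
    cases s
    · simp_all [columnHeights]
    · simp_all [columnHeights]
      omega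

theorem ofColumnHeights_columnHeights (P : List Bool) :
    ofColumnHeights (columnHeights P) = P := by
  induction P with
  | nil => rfl
  | cons s P ih =>
    obtain ⟨a, l, h⟩ := exists_columnHeights_eq_cons P
    rw [h] at ih
    cases s
    · simp [columnHeights, h, ofColumnHeights, ih]
    · cases l <;> simp_all [columnHeights, ofColumnHeights, List.replicate_succ]

theorem columnHeights_replicate_true_append (a : ℕ) (P : List Bool) :
    columnHeights (List.replicate a true ++ P) = (columnHeights P).modifyHead (· + a) := by
  obtain ⟨b, l, h⟩ := exists_columnHeights_eq_cons P
  induction a with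
  | zero => simp [h]
  | succ a ih => simp [List.replicate_succ, columnHeights, ih, h, add_assoc]

theorem columnHeights_ofColumnHeights {l : List ℕ} (hl : l ≠ []) :
    columnHeights (ofColumnHeights l) = l := by
  induction l with
  | nil => exact absurd rfl hl
  | cons a l ih =>
    cases l with
    | nil => simpa [ofColumnHeights, columnHeights] using
        columnHeights_replicate_true_append a []
    | cons b l =>
      simp [ofColumnHeights, columnHeights_replicate_true_append, columnHeights, ih]

theorem sum_take_columnHeights_le_iff (p r : List Bool) (x : ℕ) :
    ((columnHeights (p ++ true :: r)).take x).sum ≤ p.count true ↔ x ≤ p.count false := by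
  induction p generalizing x with
  | nil =>
    obtain ⟨a, l, h⟩ := exists_columnHeights_eq_cons r
    cases x <;> simp [columnHeights, h]
  | cons s p ih =>
    cases x with
    | zero => simp
    | succ x =>
      cases s
      · simp [columnHeights, ih]
      · have := ih (x + 1)
        obtain ⟨a, l, h⟩ := exists_columnHeights_eq_cons (p ++ true :: r)
        rw [h] at this
        simp [columnHeights, h] at this ⊢
        omega

/-- Every U-step of `B` is preceded by numbers of R-steps and U-steps satisfying `Q`. -/
def AtUpSteps (Q : ℕ → ℕ → Prop) (B : List Bool) : Prop :=
  ∀ p r : List Bool, B = p ++ true :: r → Q (p.count false) (p.count true)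

theorem AtUpSteps.append {Q : ℕ → ℕ → Prop} {A B : List Bool} (hA : AtUpSteps Q A)
    (hB : AtUpSteps (fun f t => Q (A.count false + f) (A.count true + t)) B) :
    AtUpSteps Q (A ++ B) := by
  intro p r h
  rcases List.append_eq_append_iff.1 h with ⟨c, rfl, rfl⟩ | ⟨c, rfl, hc⟩
  · simpa using hB c r rfl
  · cases c with
    | nil => simpa using hB [] r (by simpa using hc.symm)
    | cons s c =>
      obtain ⟨rfl, -⟩ := List.cons_eq_cons.1 hc
      exact hA p c rfl

theorem atUpSteps_replicate_true {Q : ℕ → ℕ → Prop} {m : ℕ} (h : ∀ i < m, Q 0 i) :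
    AtUpSteps Q (List.replicate m true) := by
  intro p r hp
  obtain ⟨hlen, h1, -⟩ := List.append_eq_replicate_iff.1 hp.symm
  rw [h1]
  simp only [List.length_cons] at hlen
  simpa [List.count_replicate] using h _ (by omega)

theorem atUpSteps_replicate_false (Q : ℕ → ℕ → Prop) (m : ℕ) :
    AtUpSteps Q (List.replicate m false) := by
  intro p r hp
  have : true ∈ List.replicate m false := hp ▸ by simp
  simp at this

theorem bdryStaircase_succ {k n : ℕ} (hk : 0 < k) (hn : 0 < n) :
    bdryStaircase k (n + 1) =
      List.replicate (k - 1) true ++ (List.replicate k false ++ ([true] ++ bdryStaircase k n)) := by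
  obtain ⟨k, rfl⟩ := Nat.exists_eq_succ_of_ne_zero hk.ne'
  obtain ⟨n, rfl⟩ := Nat.exists_eq_succ_of_ne_zero hn.ne'
  simp [bdryStaircase, List.replicate_succ]

theorem count_true_bdryStaircase {k n : ℕ} (hk : 0 < k) (hn : 0 < n) :
    (bdryStaircase k n).count true = n * k - 1 := by
  induction n, hn using Nat.le_induction with
  | base => simp [bdryStaircase, List.count_replicate]
  | succ n hn ih =>
    have : 0 < n * k := Nat.mul_pos hn hk
    simp [bdryStaircase_succ hk hn, List.count_replicate, ih, add_mul]
    omega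

theorem atUpSteps_bdryStaircase {k n : ℕ} (hk : 0 < k) (hn : 0 < n) :
    AtUpSteps (fun f t => f = k * ((t + 1) / k)) (bdryStaircase k n) := by
  have h0 : AtUpSteps (fun f t => f = k * ((t + 1) / k)) (List.replicate (k - 1) true) :=
    atUpSteps_replicate_true fun i hi => by simp [Nat.div_eq_of_lt (show i + 1 < k by omega)]
  induction n, hn using Nat.le_induction with
  | base => simpa [bdryStaircase] using h0.append (atUpSteps_replicate_false _ (k - 1))
  | succ n hn ih =>
    rw [bdryStaircase_succ hk hn]
    refine h0.append ((atUpSteps_replicate_false _ _).append (AtUpSteps.append ?_ ?_))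
    · refine atUpSteps_replicate_true (m := 1) fun i hi => ?_
      obtain rfl : i = 0 := by omega
      simp [List.count_replicate, Nat.sub_add_cancel hk, Nat.div_self hk]
    · intro p r h
      have := ih p r h
      simp only [List.count_replicate] at this ⊢
      simp
      rw [show k - 1 + (1 + p.count true) + 1 = p.count true + 1 + k by omega,
        Nat.add_div_right _ hk, this]
      ring

theorem exists_eq_append_true_cons {P : List Bool} {t : ℕ} (ht : t < P.count true) :
    ∃ p r, P = p ++ true :: r ∧ p.count true = t := by
  induction P generalizing t with
  | nil => simp at ht
  | cons s P ih =>
    cases s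
    · obtain ⟨p, r, rfl, rfl⟩ := ih (by simpa using ht)
      exact ⟨false :: p, r, rfl, by simp⟩
    · cases t with
      | zero => exact ⟨[], P, rfl, rfl⟩
      | succ t =>
        obtain ⟨p, r, rfl, rfl⟩ := ih (by simpa using ht)
        exact ⟨true :: p, r, rfl, by simp⟩

theorem underWord_bdryStaircase_iff {k n : ℕ} (hk : 0 < k) (hn : 0 < n) {P : List Bool}
    (hP : P.count true = n * k - 1) :
    UnderWord (bdryStaircase k n) P ↔
      ∀ j, 0 < j → j < n → ((columnHeights P).take (j * k)).sum < j * k := by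
  constructor
  · intro h j hj hjn
    have h1 : 0 < j * k := Nat.mul_pos hj hk
    have h2 : j * k < n * k := Nat.mul_lt_mul_of_pos_right hjn hk
    obtain ⟨p, r, rfl, hp⟩ := exists_eq_append_true_cons (P := P) (t := j * k - 1) (by omega)
    obtain ⟨q, s, hB, hq⟩ := exists_eq_append_true_cons (P := bdryStaircase k n)
      (t := j * k - 1) (by rw [count_true_bdryStaircase hk hn]; omega)
    have h3 := h q s p r hB rfl (hp.trans hq.symm)
    have h4 : q.count false = k * ((q.count true + 1) / k) :=
      atUpSteps_bdryStaircase hk hn q s hB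
    rw [hq, Nat.sub_add_cancel h1, Nat.mul_div_cancel _ hk, mul_comm] at h4
    have := (sum_take_columnHeights_le_iff p r (j * k)).2 (h4 ▸ h3)
    omega
  · rintro h q s p r hB rfl hpq
    have h4 : q.count false = k * ((q.count true + 1) / k) :=
      atUpSteps_bdryStaircase hk hn q s hB
    rw [h4, ← hpq, mul_comm]
    rcases Nat.eq_zero_or_pos ((p.count true + 1) / k) with h0 | h0
    · simp [h0]
    · have h5 := Nat.div_mul_le_self (p.count true + 1) k
      rw [← sum_take_columnHeights_le_iff p r]
      have h6 : (p.count true + 1) / k < n := by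
        rw [Nat.div_lt_iff_lt_mul hk]
        simp at hP
        omega
      have := h _ h0 h6
      omega

/-- The cycle lemma: if `S` drops by `1` over each period of length `n`, then exactly one starting
point within a period exceeds all values of `S` strictly inside the following period. -/
theorem existsUnique_forall_add_lt {n : ℕ} (hn : 0 < n) {S : ℕ → ℤ}
    (hS : ∀ j, S (j + n) = S j - 1) :
    ∃! r, r < n ∧ ∀ j, 0 < j → j < n → S (r + j) < S r := by
  obtain ⟨m, hm, hmax⟩ := (Finset.range n).exists_max_image S ⟨0, by simpa⟩
  let A := (Finset.range n).filter fun i => S i = S m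
  have hA : A.Nonempty := ⟨m, by simpa [A] using hm⟩
  have hr := A.max'_mem hA
  set r := A.max' hA
  simp only [A, Finset.mem_filter, Finset.mem_range] at hr
  have hr' : ∀ j, 0 < j → j < n → S (r + j) < S r := by
    intro j hj hjn
    rcases lt_or_ge (r + j) n with h | h
    · refine lt_of_le_of_ne (hr.2 ▸ hmax _ (by simpa)) fun he => ?_
      have := A.le_max' (r + j) (by simp [A, h, he, hr.2])
      omega
    · obtain ⟨i, hi⟩ := Nat.exists_eq_add_of_le' h
      rw [hi, hS, hr.2]
      have := hmax i (by simp; omega)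
      omega
  have key : ∀ a b, a < b → b < n → (∀ j, 0 < j → j < n → S (a + j) < S a) →
      (∀ j, 0 < j → j < n → S (b + j) < S b) → False := by
    intro a b hab hb ha' hb'
    have h1 := ha' (b - a) (by omega) (by omega)
    have h2 := hb' (a + n - b) (by omega) (by omega)
    rw [show a + (b - a) = b by omega] at h1
    rw [show b + (a + n - b) = a + n by omega, hS] at h2
    omega
  refine ⟨r, ⟨hr.1, hr'⟩, ?_⟩
  rintro b ⟨hb, hb'⟩
  rcases lt_trichotomy b r with h | h | h
  · exact (key b r h hr.1 hb' hr').elim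
  · exact h
  · exact (key r b h hb hr' hb').elim

theorem sum_range_natCast_zmod {M : ℕ} [NeZero M] (c : ZMod M → ℕ) :
    ∑ i ∈ Finset.range M, c i = ∑ z, c z := by
  refine Finset.sum_nbij' (fun i => (i : ZMod M)) ZMod.val ?_ ?_ ?_ ?_ ?_
  · simp
  · simp [ZMod.val_lt]
  · intro i hi
    exact ZMod.val_cast_of_lt (by simpa using hi)
  · simp
  · simp

/-- The first `j * k` values of `c` sum to less than `j * k`, for all `0 < j < n`. -/
def BlockDominated (n k : ℕ) (c : ZMod (n * k) → ℕ) : Prop :=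
  ∀ j, 0 < j → j < n → ∑ i ∈ Finset.range (j * k), c i < j * k

theorem existsUnique_rotation_blockDominated {n k : ℕ} (hn : 0 < n) [NeZero (n * k)]
    {c : ZMod (n * k) → ℕ} (hc : ∑ z, c z = n * k - 1) :
    ∃! r, r < n ∧ BlockDominated n k fun z => c (z + (r * k : ℕ)) := by
  let T : ℕ → ℕ := fun x => ∑ i ∈ Finset.range x, c i
  have hpos : 0 < n * k := Nat.pos_of_neZero _
  have hT : ∀ x, T (n * k + x) = n * k - 1 + T x := by
    intro x
    simp only [T]
    rw [Finset.sum_range_add, sum_range_natCast_zmod, hc]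
    simp only [Nat.cast_add, ZMod.natCast_self, zero_add]
  have hS : ∀ j, (T ((j + n) * k) : ℤ) - ((j + n) * k : ℕ) = (T (j * k) - (j * k : ℕ)) - 1 := by
    intro j
    rw [add_mul, add_comm (j * k), hT]
    omega
  have := existsUnique_forall_add_lt hn (S := fun j => (T (j * k) : ℤ) - (j * k : ℕ)) hS
  refine (existsUnique_congr fun r => and_congr_right fun _ => ?_).1 this
  refine forall_congr' fun j => imp_congr_right fun _ => imp_congr_right fun _ => ?_
  have h : T (r * k + j * k) =
      T (r * k) + ∑ i ∈ Finset.range (j * k), c ((i : ZMod (n * k)) + (r * k : ℕ)) := by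
    simp only [T]
    rw [Finset.sum_range_add]
    simp [add_comm]
  rw [add_mul, h]
  push_cast
  constructor <;> intro h' <;> zify at * <;> linarith

theorem mul_card_blockDominated {n k : ℕ} (hn : 0 < n) [NeZero (n * k)] :
    n * Nat.card {c : ZMod (n * k) → ℕ // ∑ z, c z = n * k - 1 ∧ BlockDominated n k c} =
      Nat.card {c : ZMod (n * k) → ℕ // ∑ z, c z = n * k - 1} := by
  have hrot : ∀ (c : ZMod (n * k) → ℕ) (a : ZMod (n * k)), ∑ z, c (z + a) = ∑ z, c z :=
    fun c a => Fintype.sum_equiv (Equiv.addRight a) _ _ fun _ => rfl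
  let Φ : Fin n × {c : ZMod (n * k) → ℕ // ∑ z, c z = n * k - 1 ∧ BlockDominated n k c} →
      {c : ZMod (n * k) → ℕ // ∑ z, c z = n * k - 1} :=
    fun p => ⟨fun z => p.2.1 (z + -((p.1 * k : ℕ) : ZMod (n * k))), (hrot _ _).trans p.2.2.1⟩
  have hΦ : Function.Bijective Φ := by
    rw [Function.bijective_iff_existsUnique]
    rintro ⟨c, hc⟩
    obtain ⟨r, ⟨hr, hg⟩, huniq⟩ := existsUnique_rotation_blockDominated hn hc
    refine ⟨(⟨r, hr⟩, ⟨_, (hrot c _).trans hc, hg⟩), by simp [Φ], ?_⟩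
    rintro ⟨⟨s, hs⟩, ⟨g, hgs, hgd⟩⟩ h
    have h' : c = fun z => g (z + -((s * k : ℕ) : ZMod (n * k))) :=
      (congrArg Subtype.val h).symm
    have hg' : (fun z => c (z + (s * k : ℕ))) = g := by
      funext z
      simp [h']
    obtain rfl := huniq s ⟨hs, by rwa [hg']⟩
    simp [← hg']
  rw [← Nat.card_eq_of_bijective Φ hΦ, Nat.card_prod, Nat.card_fin]

theorem card_sum_eq_centralBinom {M : ℕ} [NeZero M] :
    Nat.card {c : ZMod M → ℕ // ∑ z, c z = M - 1} = (M - 1).centralBinom := by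
  classical
  rw [← Nat.card_congr (Sym.equivNatSumOfFintype (ZMod M) (M - 1)), Nat.card_eq_fintype_card,
    Sym.card_sym_eq_choose, ZMod.card, Nat.centralBinom]
  congr 1
  have := Nat.pos_of_neZero M
  omega

theorem sum_range_getD (l : List ℕ) (x : ℕ) :
    ∑ i ∈ Finset.range x, l.getD i 0 = (l.take x).sum := by
  induction x generalizing l with
  | zero => simp
  | succ x ih =>
    cases l with
    | nil => simp
    | cons a l =>
      rw [Finset.sum_range_succ', List.take_succ_cons, List.sum_cons, ← ih]
      simp [add_comm]

theorem sum_range_getD_zmod {M x : ℕ} (l : List ℕ) (hx : x ≤ M) :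
    ∑ i ∈ Finset.range x, l.getD (i : ZMod M).val 0 = (l.take x).sum := by
  rw [← sum_range_getD]
  refine Finset.sum_congr rfl fun i hi => ?_
  rw [ZMod.val_cast_of_lt ((Finset.mem_range.1 hi).trans_le hx)]

theorem sum_getD_zmod {M : ℕ} [NeZero M] {l : List ℕ} (hl : l.length = M) :
    ∑ z : ZMod M, l.getD z.val 0 = l.sum := by
  rw [← sum_range_natCast_zmod, sum_range_getD_zmod l le_rfl, ← hl, List.take_length]

theorem card_underWord_bdryStaircase {n k : ℕ} (hn : 0 < n) (hk : 0 < k) [NeZero (n * k)] :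
    Nat.card {P : List Bool //
        P.count false = n * k - 1 ∧ P.count true = n * k - 1 ∧
        UnderWord (bdryStaircase k n) P} =
      Nat.card {c : ZMod (n * k) → ℕ // ∑ z, c z = n * k - 1 ∧ BlockDominated n k c} := by
  have hpos : 0 < n * k := Nat.mul_pos hn hk
  have hlen : ∀ {P : List Bool}, P.count false = n * k - 1 →
      (columnHeights P).length = n * k := fun h => by
    rw [length_columnHeights, h, Nat.sub_add_cancel hpos]
  have hdom : ∀ {P : List Bool}, P.count true = n * k - 1 →
      (UnderWord (bdryStaircase k n) P ↔
        BlockDominated n k fun z => (columnHeights P).getD z.val 0) := fun h => by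
    rw [underWord_bdryStaircase_iff hk hn h]
    refine forall_congr' fun j => imp_congr_right fun _ => imp_congr_right fun hj => ?_
    rw [sum_range_getD_zmod _ (Nat.mul_le_mul_right k hj.le)]
  refine Nat.card_eq_of_bijective (fun P => ⟨fun z => (columnHeights P.1).getD z.val 0,
    by rw [sum_getD_zmod (hlen P.2.1), sum_columnHeights, P.2.2.1],
    (hdom P.2.2.1).1 P.2.2.2⟩) ⟨?_, ?_⟩
  · rintro ⟨P, hP, _⟩ ⟨Q, hQ, _⟩ h
    have h' := congrArg Subtype.val h
    have hPQ : columnHeights P = columnHeights Q := by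
      refine List.ext_getElem ((hlen hP).trans (hlen hQ).symm) fun i hi hi' => ?_
      have := congrFun h' (i : ZMod (n * k))
      simp only [ZMod.val_cast_of_lt (hi.trans_eq (hlen hP))] at this
      rwa [List.getD_eq_getElem _ _ hi, List.getD_eq_getElem _ _ hi'] at this
    exact Subtype.ext <| (ofColumnHeights_columnHeights P).symm.trans <|
      (congrArg ofColumnHeights hPQ).trans (ofColumnHeights_columnHeights Q)
  · rintro ⟨c, hc, hcd⟩
    set l := (List.range (n * k)).map fun i : ℕ => c (i : ZMod (n * k))
    have hllen : l.length = n * k := by simp [l]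
    have hget : (fun z : ZMod (n * k) => l.getD z.val 0) = c := by
      funext z
      rw [List.getD_eq_getElem _ _ (hllen.symm ▸ ZMod.val_lt z)]
      simp [l]
    have hcol : columnHeights (ofColumnHeights l) = l :=
      columnHeights_ofColumnHeights <| List.ne_nil_of_length_pos (hllen ▸ hpos)
    have hfalse : (ofColumnHeights l).count false = n * k - 1 := by
      have := length_columnHeights (ofColumnHeights l)
      rw [hcol, hllen] at this
      omega
    have htrue : (ofColumnHeights l).count true = n * k - 1 := by
      rw [← sum_columnHeights, hcol, ← sum_getD_zmod hllen, ← hc, hget]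
    refine ⟨⟨ofColumnHeights l, hfalse, htrue, (hdom htrue).2 ?_⟩, Subtype.ext ?_⟩
    · rwa [hcol, hget]
    · simp only [hcol, hget]

theorem stmt18 (n k : ℕ) (hn : 0 < n) (hk : 0 < k) :
    Nat.card {P : List Bool //
        P.count false = n * k - 1 ∧ P.count true = n * k - 1 ∧
        UnderWord (bdryStaircase k n) P} =
      k * catalan (n * k - 1) := by
  have hpos : 0 < n * k := Nat.mul_pos hn hk
  have : NeZero (n * k) := ⟨hpos.ne'⟩
  rw [card_underWord_bdryStaircase hn hk]
  refine Nat.eq_of_mul_eq_mul_left hn ?_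
  rw [mul_card_blockDominated hn, card_sum_eq_centralBinom,
    ← succ_mul_catalan_eq_centralBinom, Nat.sub_add_cancel hpos, mul_assoc]
end
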